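/- For every r ∈ ℝ one has r²·φ_n''(r) ≤ p(p-1)·φ_n(r). -/

import Mathlib

noncomputable def phi (p : ℝ) (n : ℕ) (r : ℝ) : ℝ :=
  if |r| < n then |r| ^ p
  else (n : ℝ) ^ (p - 2) * (p * (p - 1) / 2) * (|r| - n) ^ 2
        + p * (n : ℝ) ^ (p - 1) * (|r| - n) + (n : ℝ) ^ p

open Filter Topology Set

/-- Two differentiable functions whose values and derivatives agree at `c` glue to a
differentiable function. -/
theorem hasDerivAt_ite_lt {a b a' b' : ℝ → ℝ} {c x : ℝ}
    (ha : x ≤ c → HasDerivAt a (a' x) x) (hb : c ≤ x → HasDerivAt b (b' x) x)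
    (hab : a c = b c) (hab' : a' c = b' c) :
    HasDerivAt (fun y => if y < c then a y else b y) (if x < c then a' x else b' x) x := by
  rcases lt_trichotomy x c with h | h | h
  · rw [if_pos h]
    refine (ha h.le).congr_of_eventuallyEq ?_
    filter_upwards [Iio_mem_nhds h] with y hy
    exact if_pos hy
  · subst h
    rw [if_neg (lt_irrefl x), ← hasDerivWithinAt_univ, ← Iic_union_Ici (a := x)]
    refine HasDerivWithinAt.union ?_ ?_
    · refine (hab' ▸ (ha le_rfl).hasDerivWithinAt).congr_of_mem ?_ self_mem_Iic
      intro y hy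
      rcases (mem_Iic.1 hy).lt_or_eq with hy | rfl
      · exact if_pos hy
      · simp [hab]
    · refine (hb le_rfl).hasDerivWithinAt.congr_of_mem ?_ self_mem_Ici
      intro y hy
      exact if_neg (not_lt.2 hy)
  · rw [if_neg h.not_gt]
    refine (hb h.le).congr_of_eventuallyEq ?_
    filter_upwards [Ioi_mem_nhds h] with y hy
    exact if_neg (not_lt.2 (le_of_lt hy))

theorem phi_neg (p : ℝ) (n : ℕ) (r : ℝ) : phi p n (-r) = phi p n r := by
  simp [phi]

theorem deriv_deriv_phi_neg (p : ℝ) (n : ℕ) (r : ℝ) :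
    deriv (deriv (phi p n)) (-r) = deriv (deriv (phi p n)) r := by
  have h (x : ℝ) : deriv (phi p n) (-x) = -deriv (phi p n) x := by
    have := deriv_comp_neg (phi p n) x
    simp only [phi_neg] at this
    linarith
  have := deriv_comp_neg (deriv (phi p n)) r
  simp only [h, deriv.fun_neg] at this
  linarith

theorem hasDerivAt_phi (p : ℝ) {n : ℕ} {r : ℝ} (hr : 0 < r) :
    HasDerivAt (phi p n)
      (if r < n then p * r ^ (p - 1)
        else (n : ℝ) ^ (p - 2) * (p * (p - 1)) * (r - n) + p * (n : ℝ) ^ (p - 1)) r := by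
  have key := hasDerivAt_ite_lt (c := (n : ℝ)) (x := r) (a := fun y => y ^ p)
    (a' := fun y => p * y ^ (p - 1))
    (b := fun y => (n : ℝ) ^ (p - 2) * (p * (p - 1) / 2) * (y - n) ^ 2
        + p * (n : ℝ) ^ (p - 1) * (y - n) + (n : ℝ) ^ p)
    (b' := fun y => (n : ℝ) ^ (p - 2) * (p * (p - 1)) * (y - n) + p * (n : ℝ) ^ (p - 1))
    (fun _ => Real.hasDerivAt_rpow_const (Or.inl hr.ne'))
    (fun _ => by
      have h := (hasDerivAt_id' r).sub_const (n : ℝ)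
      refine ((((h.fun_pow 2).const_mul ((n : ℝ) ^ (p - 2) * (p * (p - 1) / 2))).fun_add
        (h.const_mul (p * (n : ℝ) ^ (p - 1)))).add_const ((n : ℝ) ^ p)).congr_deriv ?_
      norm_num
      ring)
    (by simp) (by simp)
  refine key.congr_of_eventuallyEq ?_
  filter_upwards [Ioi_mem_nhds hr] with y hy
  simp only [phi, abs_of_pos (mem_Ioi.1 hy)]

theorem deriv_deriv_phi (p : ℝ) {n : ℕ} {r : ℝ} (hr : 0 < r) :
    deriv (deriv (phi p n)) r =
      if r < n then p * (p - 1) * r ^ (p - 2) else p * (p - 1) * (n : ℝ) ^ (p - 2) := by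
  have key := hasDerivAt_ite_lt (c := (n : ℝ)) (x := r) (a := fun y => p * y ^ (p - 1))
    (a' := fun y => p * (p - 1) * y ^ (p - 2))
    (b := fun y => (n : ℝ) ^ (p - 2) * (p * (p - 1)) * (y - n) + p * (n : ℝ) ^ (p - 1))
    (b' := fun _ => p * (p - 1) * (n : ℝ) ^ (p - 2))
    (fun _ => by
      refine ((Real.hasDerivAt_rpow_const (p := p - 1) (Or.inl hr.ne')).const_mul p).congr_deriv ?_
      rw [show p - 1 - 1 = p - 2 by ring]
      ring)
    (fun _ => by
      refine ((((hasDerivAt_id' r).sub_const (n : ℝ)).const_mul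
        ((n : ℝ) ^ (p - 2) * (p * (p - 1)))).add_const (p * (n : ℝ) ^ (p - 1))).congr_deriv ?_
      ring)
    (by simp) rfl
  refine (key.congr_of_eventuallyEq ?_).deriv
  filter_upwards [Ioi_mem_nhds hr] with y hy
  exact (hasDerivAt_phi p (mem_Ioi.1 hy)).deriv

theorem sq_mul_deriv_deriv_phi_le_of_pos {p : ℝ} (hp : 2 ≤ p) {n : ℕ} (hn : 1 ≤ n) {r : ℝ}
    (hr : 0 < r) : r ^ 2 * deriv (deriv (phi p n)) r ≤ p * (p - 1) * phi p n r := by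
  have hpp : 0 ≤ p * (p - 1) := mul_nonneg (by linarith) (by linarith)
  rw [deriv_deriv_phi p hr, phi, abs_of_pos hr]
  split_ifs with h
  · have h2 : r ^ p = r ^ (p - 2) * r ^ 2 := by
      rw [← Real.rpow_add_natCast hr.ne']
      norm_num
    rw [h2]
    exact le_of_eq (by ring)
  · have hn0 : (0 : ℝ) < n := by exact_mod_cast hn
    have h1 : (n : ℝ) ^ (p - 1) = (n : ℝ) ^ (p - 2) * n := by
      rw [← Real.rpow_add_one hn0.ne']
      ring_nf
    have h2 : (n : ℝ) ^ p = (n : ℝ) ^ (p - 2) * n ^ 2 := by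
      rw [← Real.rpow_add_natCast hn0.ne']
      norm_num
    have hs : 0 ≤ r - n := by linarith
    have hq : r ^ 2 ≤ p * (p - 1) / 2 * (r - n) ^ 2 + p * n * (r - n) + n ^ 2 := by
      have e1 : 0 ≤ (p * (p - 1) / 2 - 1) * (r - n) ^ 2 :=
        mul_nonneg (by nlinarith) (sq_nonneg _)
      have e2 : 0 ≤ (p - 2) * (n * (r - n)) :=
        mul_nonneg (by linarith) (mul_nonneg hn0.le hs)
      linarith
    rw [h1, h2]
    calc r ^ 2 * (p * (p - 1) * (n : ℝ) ^ (p - 2))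
        = p * (p - 1) * (n : ℝ) ^ (p - 2) * r ^ 2 := by ring
      _ ≤ p * (p - 1) * (n : ℝ) ^ (p - 2) *
          (p * (p - 1) / 2 * (r - n) ^ 2 + p * n * (r - n) + n ^ 2) := by gcongr
      _ = _ := by ring

theorem phi_sq_mul_second_deriv_bound (p : ℝ) (hp : 2 ≤ p) (n : ℕ) (hn : 1 ≤ n) :
    ∀ r : ℝ, r ^ 2 * deriv (deriv (phi p n)) r ≤ p * (p - 1) * phi p n r := by
  intro r
  rcases lt_trichotomy r 0 with h | rfl | h
  · have := sq_mul_deriv_deriv_phi_le_of_pos hp hn (neg_pos.2 h)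
    rwa [neg_sq, deriv_deriv_phi_neg, phi_neg] at this
  · have hn0 : (0 : ℝ) < n := by exact_mod_cast hn
    have hp0 : p ≠ 0 := by linarith
    simp [phi, hn0, Real.zero_rpow hp0]
  · exact sq_mul_deriv_deriv_phi_le_of_pos hp hn h
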